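/- arXiv:1007.4488 — 2 statements merged into one kernel-verified Lean document; each statement's English description precedes it below -/
import Mathlib

section
/- The operator P = T*T + TT*, with domain Dom P = {u ∈ Dom T ∩ Dom T* : Tu ∈ Dom T*, T*u ∈ Dom T}, is a densely defined, closed, self-adjoint operator on H, and ⟨Pu, u⟩ = ‖Tu‖² + ‖T*u‖² ≥ 0 for every u ∈ Dom P. -/
open scoped LinearPMap

namespace LinearPMap

variable {𝕜 E F : Type*} [RCLike 𝕜] [NormedAddCommGroup E] [InnerProductSpace 𝕜 E]
  [NormedAddCommGroup F] [InnerProductSpace 𝕜 F]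

/-- A symmetric operator `S` such that `1 + S` is surjective has dense domain. -/
theorem IsFormalAdjoint.dense_domain_of_surjective [CompleteSpace E] {S : E →ₗ.[𝕜] E}
    (hS : S.IsFormalAdjoint S) (hsurj : ∀ f : E, ∃ u : S.domain, (u : E) + S u = f) :
    Dense (S.domain : Set E) := by
  rw [Submodule.dense_iff_topologicalClosure_eq_top, Submodule.topologicalClosure_eq_top_iff,
    Submodule.eq_bot_iff]
  intro z hz
  obtain ⟨u, rfl⟩ := hsurj z
  have hu : (u : E) = 0 := by
    rw [← inner_self_eq_zero (𝕜 := 𝕜)]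
    obtain ⟨v, hv⟩ := hsurj u
    have h := (Submodule.mem_orthogonal' _ _).1 hz v v.2
    rw [inner_add_left, hS u v, ← inner_add_right, hv] at h
    exact h
  have hu' : u = 0 := Subtype.ext hu
  simp [hu']

/-- A symmetric operator `S` such that `1 + S` is surjective is self-adjoint. -/
theorem IsFormalAdjoint.isSelfAdjoint_of_surjective [CompleteSpace E] {S : E →ₗ.[𝕜] E}
    (hS : S.IsFormalAdjoint S) (hsurj : ∀ f : E, ∃ u : S.domain, (u : E) + S u = f) :
    IsSelfAdjoint S := by
  have hd := hS.dense_domain_of_surjective hsurj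
  have hle := hS.le_adjoint hd
  rw [isSelfAdjoint_def]
  refine (eq_of_le_of_domain_eq hle (le_antisymm hle.1 fun y hy => ?_)).symm
  obtain ⟨u, hu⟩ := hsurj (y + S† ⟨y, hy⟩)
  suffices h : y - u = 0 by
    rw [sub_eq_zero.1 h]
    exact u.2
  rw [← inner_self_eq_zero (𝕜 := 𝕜)]
  obtain ⟨v, hv⟩ := hsurj (y - u)
  have h1 : inner 𝕜 (S† ⟨y, hy⟩) (v : E) = inner 𝕜 y (S v) :=
    adjoint_isFormalAdjoint hd ⟨y, hy⟩ v
  have h2 := hS u v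
  have h3 := congrArg (fun w => inner 𝕜 w (v : E)) hu
  simp only [inner_add_left, h1, h2] at h3
  nth_rewrite 2 [← hv]
  rw [inner_sub_left, inner_add_right, inner_add_right, h3, sub_self]

/-- The orthogonal decomposition of `E × F` into the graph of a closed densely defined operator
`T` and the rotated graph of its adjoint. -/
theorem exists_eq_graph_add_adjoint_graph [CompleteSpace E] [CompleteSpace F] {T : E →ₗ.[𝕜] F}
    (hTd : Dense (T.domain : Set E)) (hTc : T.IsClosed) (f : E) (g : F) :
    ∃ (u : T.domain) (b : (T†).domain), (u : E) - T† b = f ∧ T u + b = g := by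
  let G : Submodule 𝕜 (WithLp 2 (E × F)) :=
    T.graph.comap (WithLp.linearEquiv 2 𝕜 (E × F) : WithLp 2 (E × F) →ₗ[𝕜] E × F)
  have hG : _root_.IsClosed (G : Set (WithLp 2 (E × F))) :=
    _root_.IsClosed.preimage (WithLp.prod_continuous_ofLp 2 E F) hTc
  have : CompleteSpace G := hG.completeSpace_coe
  obtain ⟨p, hp, q, hq, hpq⟩ := G.exists_add_mem_mem_orthogonal (WithLp.toLp 2 (f, g))
  obtain ⟨u, hu1, hu2⟩ := (mem_graph_iff T).1 hp
  have horth (x : T.domain) : inner 𝕜 (-q.fst) (x : E) = inner 𝕜 q.snd (T x) := by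
    have h := (Submodule.mem_orthogonal' _ _).1 hq (WithLp.toLp 2 ((x : E), T x))
      (T.mem_graph x)
    rw [WithLp.prod_inner_apply] at h
    rw [inner_neg_left]
    exact neg_eq_of_add_eq_zero_right h
  have hb : q.snd ∈ (T†).domain := mem_adjoint_domain_of_exists _ ⟨_, horth⟩
  refine ⟨u, ⟨q.snd, hb⟩, ?_, ?_⟩
  · rw [adjoint_apply_eq hTd ⟨q.snd, hb⟩ horth, hu1, sub_neg_eq_add]
    exact (congrArg WithLp.fst hpq).symm
  · rw [hu2]
    exact (congrArg WithLp.snd hpq).symm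

/-- A vector orthogonal to the range of `T` lies in the kernel of the adjoint. -/
theorem exists_adjoint_eq_zero [CompleteSpace E] {T : E →ₗ.[𝕜] F}
    (hTd : Dense (T.domain : Set E)) {y : F} (hy : ∀ x : T.domain, inner 𝕜 y (T x) = 0) :
    ∃ h : y ∈ (T†).domain, T† ⟨y, h⟩ = 0 :=
  have h0 (x : T.domain) : inner 𝕜 (0 : E) (x : E) = inner 𝕜 y (T x) := by
    rw [hy, inner_zero_left]
  ⟨mem_adjoint_domain_of_exists _ ⟨0, h0⟩, adjoint_apply_eq hTd _ h0⟩

/-- The kernel of an operator, as a submodule of the ambient space. -/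
def kernel (T : E →ₗ.[𝕜] F) : Submodule 𝕜 E :=
  T.graph.comap (LinearMap.inl 𝕜 E F)

theorem mem_kernel_iff {T : E →ₗ.[𝕜] F} {x : E} :
    x ∈ T.kernel ↔ ∃ h : x ∈ T.domain, T ⟨x, h⟩ = 0 := by
  simp [kernel, mem_graph_iff]

theorem IsClosed.isClosed_kernel {T : E →ₗ.[𝕜] F} (hT : T.IsClosed) :
    _root_.IsClosed (T.kernel : Set E) :=
  _root_.IsClosed.preimage (by fun_prop : Continuous fun x : E => (x, (0 : F))) hT

/-- If `T` is closed, densely defined and `T² = 0`, then `1 + T*T + TT*` is surjective. -/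
theorem exists_add_laplacian_eq [CompleteSpace E] {T : E →ₗ.[𝕜] E}
    (hTd : Dense (T.domain : Set E)) (hTc : T.IsClosed)
    (hT2 : ∀ u : T.domain, T u ∈ T.kernel) (f : E) :
    ∃ (u : E) (h1 : u ∈ T.domain) (h2 : u ∈ (T†).domain) (h3 : T ⟨u, h1⟩ ∈ (T†).domain)
      (h4 : T† ⟨u, h2⟩ ∈ T.domain), u + (T† ⟨T ⟨u, h1⟩, h3⟩ + T ⟨T† ⟨u, h2⟩, h4⟩) = f := by
  have : CompleteSpace T.kernel := hTc.isClosed_kernel.completeSpace_coe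
  obtain ⟨f₁, hf₁, f₂, hf₂, rfl⟩ := T.kernel.exists_add_mem_mem_orthogonal f
  obtain ⟨v, c, hvc, hc⟩ := exists_eq_graph_add_adjoint_graph hTd hTc f₂ 0
  obtain ⟨w, b, hwb, hb⟩ := exists_eq_graph_add_adjoint_graph hTd hTc 0 f₁
  have hcv : (c : E) = -T v := (neg_eq_of_add_eq_zero_right hc).symm
  have hwb : (w : E) = T† b := sub_eq_zero.1 hwb
  obtain ⟨hv, hv0⟩ : ∃ h : (v : E) ∈ (T†).domain, T† ⟨v, h⟩ = 0 := by
    refine exists_adjoint_eq_zero hTd fun x => ?_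
    rw [sub_eq_iff_eq_add.1 hvc, inner_add_left,
      (Submodule.mem_orthogonal' _ _).1 hf₂ _ (hT2 x), zero_add]
    obtain ⟨hx, hx0⟩ := mem_kernel_iff.1 (hT2 x)
    have h : inner 𝕜 (T† c) (T x) = inner 𝕜 (c : E) (T ⟨T x, hx⟩) :=
      adjoint_isFormalAdjoint hTd c ⟨T x, hx⟩
    rw [h, hx0, inner_zero_right]
  obtain ⟨hb', hb0⟩ : ∃ h : (b : E) ∈ T.domain, T ⟨b, h⟩ = 0 := by
    rw [← mem_kernel_iff, eq_sub_of_add_eq' hb]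
    exact T.kernel.sub_mem hf₁ (hT2 w)
  have e1 : T ⟨b + v, T.domain.add_mem hb' v.2⟩ = -c := by
    rw [hcv, neg_neg]
    exact (T.map_add ⟨b, hb'⟩ v).trans (by rw [hb0, zero_add])
  have e2 : T† ⟨b + v, (T†).domain.add_mem b.2 hv⟩ = w := by
    rw [hwb]
    exact ((T†).map_add b ⟨v, hv⟩).trans (by rw [hv0, add_zero])
  have h3 : T ⟨b + v, T.domain.add_mem hb' v.2⟩ ∈ (T†).domain := by
    rw [e1]
    exact (T†).domain.neg_mem c.2
  have h4 : T† ⟨b + v, (T†).domain.add_mem b.2 hv⟩ ∈ T.domain := by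
    rw [e2]
    exact w.2
  have e3 : T† ⟨_, h3⟩ = -T† c := (congrArg (T†) (Subtype.ext e1)).trans ((T†).map_neg c)
  have e4 : T ⟨_, h4⟩ = T w := congrArg T (Subtype.ext e2)
  refine ⟨b + v, T.domain.add_mem hb' v.2, (T†).domain.add_mem b.2 hv, h3, h4, ?_⟩
  rw [e3, e4, ← hvc, ← hb]
  abel

end LinearPMap

/-- `P = T*T + TT*` (with domain `{u ∈ Dom T ∩ Dom T* : Tu ∈ Dom T*, T*u ∈ Dom T}`) is a
densely defined closed self-adjoint operator with `⟨Pu, u⟩ = ‖Tu‖² + ‖T*u‖² ≥ 0`. -/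
theorem stmt_1 {H : Type*} [NormedAddCommGroup H] [InnerProductSpace ℂ H] [CompleteSpace H]
    (T : H →ₗ.[ℂ] H) (hTd : Dense (T.domain : Set H)) (hTc : T.IsClosed)
    (hTr : ∀ u : T.domain, T u ∈ T.domain)
    (hT2 : ∀ u : T.domain, T ⟨T u, hTr u⟩ = 0)
    (P : H →ₗ.[ℂ] H)
    (hPdom : ∀ x : H, x ∈ P.domain ↔
      ∃ (h1 : x ∈ T.domain) (h2 : x ∈ (T†).domain),
        T ⟨x, h1⟩ ∈ (T†).domain ∧ T† ⟨x, h2⟩ ∈ T.domain)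
    (hPval : ∀ (x : H) (hx : x ∈ P.domain) (h1 : x ∈ T.domain) (h2 : x ∈ (T†).domain)
      (h3 : T ⟨x, h1⟩ ∈ (T†).domain) (h4 : T† ⟨x, h2⟩ ∈ T.domain),
      P ⟨x, hx⟩ = T† ⟨T ⟨x, h1⟩, h3⟩ + T ⟨T† ⟨x, h2⟩, h4⟩) :
    Dense (P.domain : Set H) ∧ P.IsClosed ∧ IsSelfAdjoint P ∧
    ∀ (u : P.domain) (h1 : (u : H) ∈ T.domain) (h2 : (u : H) ∈ (T†).domain),
      (inner ℂ (P u) ((u : H)) : ℂ) =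
        ((‖T ⟨(u : H), h1⟩‖ ^ 2 + ‖T† ⟨(u : H), h2⟩‖ ^ 2 : ℝ) : ℂ) := by
  have hform (u v : P.domain) (h1 : (u : H) ∈ T.domain) (h2 : (u : H) ∈ (T†).domain)
      (k1 : (v : H) ∈ T.domain) (k2 : (v : H) ∈ (T†).domain) :
      inner ℂ (P u) (v : H) =
        inner ℂ (T ⟨u, h1⟩) (T ⟨v, k1⟩) + inner ℂ (T† ⟨u, h2⟩) (T† ⟨v, k2⟩) := by
    obtain ⟨_, _, h3, h4⟩ := (hPdom u).1 u.2
    rw [hPval u u.2 h1 h2 h3 h4, inner_add_left]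
    exact congrArg₂ (· + ·) (T.adjoint_isFormalAdjoint hTd ⟨_, h3⟩ ⟨v, k1⟩)
      ((T.adjoint_isFormalAdjoint hTd).symm ⟨_, h4⟩ ⟨v, k2⟩)
  have hsymm : P.IsFormalAdjoint P := fun u v => by
    obtain ⟨h1, h2, -⟩ := (hPdom u).1 u.2
    obtain ⟨k1, k2, -⟩ := (hPdom v).1 v.2
    rw [← inner_conj_symm (u : H), hform u v h1 h2 k1 k2, hform v u k1 k2 h1 h2, map_add,
      inner_conj_symm, inner_conj_symm]
  have hsurj (f : H) : ∃ u : P.domain, (u : H) + P u = f := by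
    obtain ⟨u, h1, h2, h3, h4, hu⟩ := LinearPMap.exists_add_laplacian_eq hTd hTc
      (fun u => LinearPMap.mem_kernel_iff.2 ⟨hTr u, hT2 u⟩) f
    refine ⟨⟨u, (hPdom u).2 ⟨h1, h2, h3, h4⟩⟩, ?_⟩
    rw [hPval u _ h1 h2 h3 h4, hu]
  have hsa := hsymm.isSelfAdjoint_of_surjective hsurj
  refine ⟨hsa.dense_domain, hsa.isClosed, hsa, fun u h1 h2 => ?_⟩
  rw [hform u u h1 h2 h1 h2, inner_self_eq_norm_sq_to_K, inner_self_eq_norm_sq_to_K]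
  push_cast
  rfl
end

section
/- The Green operator factors as N = j ∘ j*, where j : D → V₂ is the bounded inclusion and j* : V₂ → D its Hilbert-space adjoint. Equivalently: for every u ∈ V₂ the element Nu lies in D, and ⟨T(Nu), Tv⟩ + ⟨T*(Nu), T*v⟩ = ⟨u, v⟩ for all v ∈ D. -/
open scoped LinearPMap

/-- `T'` is the restriction of the partially defined operator `T` to the subspaces `V` (source)
and `W` (target): the domain of `T'` consists exactly of the elements of `V` lying in the domain
of `T`, and the values of `T'` agree with those of `T` (in particular `T` maps `Dom T ∩ V`
into `W`). -/
def IsRestrictionOf {R E : Type*} [Ring R] [AddCommGroup E] [Module R E]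
    (T : E →ₗ.[R] E) (V W : Submodule R E) (T' : ↥V →ₗ.[R] ↥W) : Prop :=
  (∀ u : V, u ∈ T'.domain ↔ (u : E) ∈ T.domain) ∧
  ∀ (u : V) (hu : u ∈ T'.domain) (hu' : (u : E) ∈ T.domain),
    ((T' ⟨u, hu⟩ : W) : E) = T ⟨(u : E), hu'⟩

section GraphDecomposition

variable {𝕜 E F G : Type*} [RCLike 𝕜]
  [NormedAddCommGroup E] [InnerProductSpace 𝕜 E]
  [NormedAddCommGroup F] [InnerProductSpace 𝕜 F]
  [NormedAddCommGroup G] [InnerProductSpace 𝕜 G]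

theorem eq_zero_of_inner_add_eq_zero {z c : E} {b : F} (hzc : inner 𝕜 z c = inner 𝕜 b b)
    (h : inner 𝕜 (z + c) c = 0) : b = 0 ∧ c = 0 := by
  rw [inner_add_left, hzc, inner_self_eq_norm_sq_to_K, inner_self_eq_norm_sq_to_K] at h
  have h' : ‖b‖ ^ 2 + ‖c‖ ^ 2 = 0 := by exact_mod_cast h
  constructor <;> rw [← norm_eq_zero] <;> nlinarith [sq_nonneg ‖b‖, sq_nonneg ‖c‖]

variable [CompleteSpace E]

theorem LinearPMap.inner_eq_of_mem_graph_adjoint {A : E →ₗ.[𝕜] F}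
    (hA : Dense (A.domain : Set E)) {x p : E} {y q : F}
    (hxy : (x, y) ∈ A.graph) (hqp : (q, p) ∈ A†.graph) :
    inner 𝕜 p x = inner 𝕜 q y := by
  obtain ⟨x, rfl, rfl⟩ := A.mem_graph_iff.1 hxy
  obtain ⟨q, rfl, rfl⟩ := A†.mem_graph_iff.1 hqp
  exact LinearPMap.adjoint_isFormalAdjoint hA q x

theorem LinearPMap.mem_graph_adjoint_of_inner_eq {A : E →ₗ.[𝕜] F}
    (hA : Dense (A.domain : Set E)) {p : E} {q : F}
    (h : ∀ x y, (x, y) ∈ A.graph → inner 𝕜 p x = inner 𝕜 q y) :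
    (q, p) ∈ A†.graph := by
  have h' : ∀ x : A.domain, inner 𝕜 p (x : E) = inner 𝕜 q (A x) :=
    fun x => h x (A x) (A.mem_graph x)
  have hq : q ∈ A†.domain := LinearPMap.mem_adjoint_domain_of_exists q ⟨p, h'⟩
  exact (A†).mem_graph_iff.2 ⟨⟨q, hq⟩, rfl, LinearPMap.adjoint_apply_eq hA ⟨q, hq⟩ h'⟩

variable [CompleteSpace F]

/-- Orthogonal decomposition of `E × F` into the graph of a closed operator and the rotated graph
of its adjoint. -/
theorem LinearPMap.exists_graph_adjoint_decomposition {A : E →ₗ.[𝕜] F}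
    (hA : Dense (A.domain : Set E)) (hAc : A.IsClosed) (a : E) (b : F) :
    ∃ x y q p, (x, y) ∈ A.graph ∧ (q, p) ∈ A†.graph ∧ x - p = a ∧ y + q = b := by
  let K : Submodule 𝕜 (WithLp 2 (E × F)) :=
    A.graph.comap (WithLp.linearEquiv 2 𝕜 (E × F)).toLinearMap
  have hK : _root_.IsClosed (K : Set (WithLp 2 (E × F))) :=
    _root_.IsClosed.preimage (WithLp.prodContinuousLinearEquiv 2 𝕜 E F).continuous hAc
  have : CompleteSpace K := hK.completeSpace_coe
  obtain ⟨g, hg, o, ho, hgo⟩ := K.exists_add_mem_mem_orthogonal (WithLp.toLp 2 (a, b))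
  refine ⟨g.fst, g.snd, o.snd, -o.fst, hg, mem_graph_adjoint_of_inner_eq hA ?_, ?_, ?_⟩
  · intro x y hxy
    have h := K.inner_left_of_mem_orthogonal (u := WithLp.toLp 2 (x, y)) hxy ho
    rw [WithLp.prod_inner_apply] at h
    rw [inner_neg_left]
    exact neg_eq_of_add_eq_zero_right h
  · rw [sub_neg_eq_add]
    exact (congrArg WithLp.fst hgo).symm
  · exact (congrArg WithLp.snd hgo).symm

variable [CompleteSpace G]

/-- For a complex `E → F → G` of closed densely defined operators, a vector orthogonal to the
range of the Laplacian `AA* + B*B` is harmonic. -/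
theorem LinearPMap.mem_ker_of_orthogonal_laplacian {A : E →ₗ.[𝕜] F} {B : F →ₗ.[𝕜] G}
    (hA : Dense (A.domain : Set E)) (hAc : A.IsClosed)
    (hB : Dense (B.domain : Set F)) (hBc : B.IsClosed)
    (hAB : ∀ x y, (x, y) ∈ A.graph → (y, 0) ∈ B.graph) {w : F}
    (hw : ∀ z p q b c, (z, p) ∈ A†.graph → (p, q) ∈ A.graph → (z, b) ∈ B.graph →
      (b, c) ∈ B†.graph → inner 𝕜 w (c + q) = 0) :
    (w, 0) ∈ A†.graph ∧ (w, 0) ∈ B.graph := by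
  let K : Submodule 𝕜 F := B.graph.comap (LinearMap.inl 𝕜 F G)
  have hK : _root_.IsClosed (K : Set F) :=
    _root_.IsClosed.preimage (f := fun x : F => (x, (0 : G))) (by fun_prop) hBc
  have : CompleteSpace K := hK.completeSpace_coe
  have hKo : ∀ v ∈ Kᗮ, (v, 0) ∈ A†.graph := fun v hv =>
    mem_graph_adjoint_of_inner_eq hA fun x y hxy => by
      rw [inner_zero_left, K.inner_left_of_mem_orthogonal (hAB x y hxy) hv]
  obtain ⟨k, hk, v, hv, rfl⟩ := K.exists_add_mem_mem_orthogonal w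
  have hk0 : (k, 0) ∈ A†.graph := by
    obtain ⟨p, q, z, p', hpq, hzp, hp, rfl⟩ := exists_graph_adjoint_decomposition hA hAc 0 k
    obtain rfl := sub_eq_zero.1 hp
    have hq : q ∈ K := hAB _ _ hpq
    have hz : z ∈ K := by simpa using K.sub_mem hk hq
    have h := hw z p q 0 0 hzp hpq hz B†.graph.zero_mem
    rw [zero_add, inner_add_left, K.inner_left_of_mem_orthogonal hq hv, add_zero,
      add_comm q] at h
    obtain ⟨rfl, rfl⟩ :=
      eq_zero_of_inner_add_eq_zero (inner_eq_of_mem_graph_adjoint hA hpq hzp).symm h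
    simpa using hzp
  have hv0 : v = 0 := by
    obtain ⟨z, b, b', c, hzb, hbc, hz, hb⟩ := exists_graph_adjoint_decomposition hB hBc v 0
    have hbc' : (b, -c) ∈ B†.graph := by
      have := B†.graph.neg_mem hbc
      rwa [Prod.neg_mk, ← eq_neg_of_add_eq_zero_left hb] at this
    have hc : -c ∈ Kᗮ := (K.mem_orthogonal' _).2 fun u hu => by
      exact (inner_eq_of_mem_graph_adjoint hB hu hbc').trans (inner_zero_right b)
    have hzv : z + -c = v := by rw [← hz, sub_eq_add_neg]
    have hzK : z ∈ Kᗮ := by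
      rw [eq_sub_of_add_eq hzv]
      exact Kᗮ.sub_mem hv hc
    have h := hw z 0 0 b (-c) (hKo z hzK) A.graph.zero_mem hzb hbc'
    rw [add_zero, inner_add_left, K.inner_right_of_mem_orthogonal hk hc, zero_add, ← hzv] at h
    have hzc : inner 𝕜 z (-c) = inner 𝕜 b b := by
      rw [← inner_conj_symm, inner_eq_of_mem_graph_adjoint hB hzb hbc', inner_conj_symm]
    obtain ⟨rfl, hc0⟩ := eq_zero_of_inner_add_eq_zero hzc h
    rw [hc0, add_zero] at hzv
    subst hzv
    exact inner_self_eq_zero.1 (K.inner_right_of_mem_orthogonal hzb hzK)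
  rw [hv0, add_zero]
  exact ⟨hk0, hk⟩

end GraphDecomposition

theorem IsRestrictionOf.mem_graph_iff {R E : Type*} [Ring R] [AddCommGroup E] [Module R E]
    {T : E →ₗ.[R] E} {V W : Submodule R E} {T' : ↥V →ₗ.[R] ↥W}
    (h : IsRestrictionOf T V W T') {x : V} {y : W} :
    (x, y) ∈ T'.graph ↔ ((x : E), (y : E)) ∈ T.graph := by
  simp only [LinearPMap.mem_graph_iff]
  constructor
  · rintro ⟨z, rfl, rfl⟩
    exact ⟨⟨_, (h.1 z).1 z.2⟩, rfl, (h.2 z z.2 _).symm⟩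
  · rintro ⟨z, hz, hy⟩
    have hx : (x : E) ∈ T.domain := hz ▸ z.2
    obtain rfl : z = ⟨x, hx⟩ := Subtype.ext hz
    exact ⟨⟨x, (h.1 x).2 hx⟩, rfl, Subtype.ext ((h.2 x _ hx).trans hy)⟩

theorem IsRestrictionOf.isClosed {R E : Type*} [CommRing R] [AddCommGroup E] [Module R E]
    [TopologicalSpace E] {T : E →ₗ.[R] E} {V W : Submodule R E} {T' : ↥V →ₗ.[R] ↥W}
    (h : IsRestrictionOf T V W T') (hT : T.IsClosed) : T'.IsClosed := by
  have : (T'.graph : Set (V × W)) =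
      (fun z : V × W => ((z.1 : E), (z.2 : E))) ⁻¹' (T.graph : Set (E × E)) :=
    Set.ext fun z => h.mem_graph_iff
  unfold LinearPMap.IsClosed
  rw [this]
  exact IsClosed.preimage (by fun_prop) hT

theorem stmt_9 {H : Type*} [NormedAddCommGroup H] [InnerProductSpace ℂ H] [CompleteSpace H]
    -- `T` is closed and densely defined, with range contained in `Dom T` and `T² = 0`
    (T : H →ₗ.[ℂ] H) (hTd : Dense (T.domain : Set H)) (hTc : T.IsClosed)
    (hTr : ∀ u : T.domain, T u ∈ T.domain)
    (hT2 : ∀ u : T.domain, T ⟨T u, hTr u⟩ = 0)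
    -- `P = T*T + TT*` with its natural domain; `P` is self-adjoint
    (P : H →ₗ.[ℂ] H)
    (hPdom : ∀ x : H, x ∈ P.domain ↔
      ∃ (h1 : x ∈ T.domain) (h2 : x ∈ (T†).domain),
        T ⟨x, h1⟩ ∈ (T†).domain ∧ T† ⟨x, h2⟩ ∈ T.domain)
    (hPval : ∀ (x : H) (hx : x ∈ P.domain) (h1 : x ∈ T.domain) (h2 : x ∈ (T†).domain)
      (h3 : T ⟨x, h1⟩ ∈ (T†).domain) (h4 : T† ⟨x, h2⟩ ∈ T.domain),
      P ⟨x, hx⟩ = T† ⟨T ⟨x, h1⟩, h3⟩ + T ⟨T† ⟨x, h2⟩, h4⟩)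
    (hPsa : IsSelfAdjoint P)
    -- the closed subspaces `V₁, V₂, V₃`
    (V₁ V₂ V₃ : Submodule ℂ H)
    (hV₁ : IsClosed (V₁ : Set H)) (hV₂ : IsClosed (V₂ : Set H)) (hV₃ : IsClosed (V₃ : Set H))
    [CompleteSpace V₁] [CompleteSpace V₂] [CompleteSpace V₃]
    -- `T₁ = T|_{V₁} : V₁ ⇀ V₂` and `T₂ = T|_{V₂} : V₂ ⇀ V₃`, densely defined with closed range
    (T₁ : ↥V₁ →ₗ.[ℂ] ↥V₂) (hT₁ : IsRestrictionOf T V₁ V₂ T₁)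
    (hT₁d : Dense (T₁.domain : Set V₁))
    (T₂ : ↥V₂ →ₗ.[ℂ] ↥V₃) (hT₂ : IsRestrictionOf T V₂ V₃ T₂)
    (hT₂d : Dense (T₂.domain : Set V₂))
    (hR₁ : IsClosed ((LinearMap.range T₁.toFun : Submodule ℂ V₂) : Set V₂))
    (hR₂ : IsClosed ((LinearMap.range T₂.toFun : Submodule ℂ V₃) : Set V₃))
    -- `S₂ = T*|_{V₂} : V₂ ⇀ V₁` and `S₃ = T*|_{V₃} : V₃ ⇀ V₂`; the adjoint of `T|_{V₁}` is
    -- `T*|_{V₂}` and the adjoint of `T|_{V₂}` is `T*|_{V₃}`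
    (S₂ : ↥V₂ →ₗ.[ℂ] ↥V₁) (hS₂ : IsRestrictionOf (T†) V₂ V₁ S₂)
    (S₃ : ↥V₃ →ₗ.[ℂ] ↥V₂) (hS₃ : IsRestrictionOf (T†) V₃ V₂ S₃)
    (hadj₁ : T₁† = S₂) (hadj₂ : T₂† = S₃)
    -- `Q = P|_{V₂}`
    (Q : ↥V₂ →ₗ.[ℂ] ↥V₂) (hQ : IsRestrictionOf P V₂ V₂ Q)
    -- `N = Q⁻¹` is the Green operator
    (N : V₂ →L[ℂ] V₂)
    (hN0 : ∀ u ∈ (LinearMap.ker Q.toFun).map Q.domain.subtype, N u = 0)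
    (hNR : ∀ u ∈ LinearMap.range Q.toFun, ∃ h : N u ∈ Q.domain,
      N u ∈ LinearMap.range Q.toFun ∧ Q ⟨N u, h⟩ = u) :
    -- `N = j ∘ j*`: for every `u`, `Nu` lies in `D = Dom T ∩ Dom T* ∩ R(Q)` and
    -- `⟨T(Nu), Tv⟩ + ⟨T*(Nu), T*v⟩ = ⟨u, v⟩` for all `v ∈ D`
    ∀ u : V₂, ∃ (h1 : ((N u : V₂) : H) ∈ T.domain) (h2 : ((N u : V₂) : H) ∈ (T†).domain),
      N u ∈ LinearMap.range Q.toFun ∧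
      ∀ (v : V₂) (hv1 : (v : H) ∈ T.domain) (hv2 : (v : H) ∈ (T†).domain),
        v ∈ LinearMap.range Q.toFun →
          (inner ℂ (T ⟨((N u : V₂) : H), h1⟩) (T ⟨(v : H), hv1⟩) : ℂ) +
            (inner ℂ (T† ⟨((N u : V₂) : H), h2⟩) (T† ⟨(v : H), hv2⟩) : ℂ) =
            (inner ℂ ((u : H)) ((v : H)) : ℂ) := by
  have hPgraph : ∀ {z p q b c : H}, (z, p) ∈ T†.graph → (p, q) ∈ T.graph →
      (z, b) ∈ T.graph → (b, c) ∈ T†.graph → (z, c + q) ∈ P.graph := by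
    intro z p q b c hzp hpq hzb hbc
    simp only [LinearPMap.mem_graph_iff] at hzp hpq hzb hbc ⊢
    obtain ⟨⟨z, hz⟩, rfl, rfl⟩ := hzp
    obtain ⟨⟨p, hp⟩, rfl, rfl⟩ := hpq
    obtain ⟨⟨z, hz'⟩, rfl, rfl⟩ := hzb
    obtain ⟨⟨b, hb⟩, rfl, rfl⟩ := hbc
    exact ⟨⟨z, (hPdom z).2 ⟨hz', hz, hb, hp⟩⟩, rfl, hPval z _ hz' hz hb hp⟩
  have hrange : ∀ {z y : V₂}, ((z : H), (y : H)) ∈ P.graph → y ∈ LinearMap.range Q.toFun := by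
    intro z y hzy
    obtain ⟨x, -, hx⟩ := Q.mem_graph_iff.1 (hQ.mem_graph_iff.2 hzy)
    exact ⟨x, hx⟩
  have hNgraph : ∀ {y : V₂}, y ∈ LinearMap.range Q.toFun →
      (((N y : V₂) : H), (y : H)) ∈ P.graph := by
    intro y hy
    obtain ⟨h, -, hQy⟩ := hNR y hy
    exact hQ.mem_graph_iff.1 (Q.mem_graph_iff.2 ⟨⟨N y, h⟩, rfl, hQy⟩)
  have hRclosed : IsClosed ((LinearMap.range Q.toFun : Submodule ℂ V₂) : Set V₂) := by
    have : ((LinearMap.range Q.toFun : Submodule ℂ V₂) : Set V₂) =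
        (fun y : V₂ => (((N y : V₂) : H), (y : H))) ⁻¹' (P.graph : Set (H × H)) :=
      Set.ext fun y => ⟨hNgraph, hrange⟩
    rw [this]
    exact IsClosed.preimage (by fun_prop) hPsa.isClosed
  have : CompleteSpace (LinearMap.range Q.toFun) := hRclosed.completeSpace_coe
  subst hadj₁ hadj₂
  have hNorth : ∀ w ∈ (LinearMap.range Q.toFun)ᗮ, N w = 0 := by
    intro w hw
    obtain ⟨h1, h2⟩ := LinearPMap.mem_ker_of_orthogonal_laplacian hT₁d (hT₁.isClosed hTc)
      hT₂d (hT₂.isClosed hTc) (w := w)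
      (fun x y hxy => by
        rw [hT₂.mem_graph_iff]
        obtain ⟨x', -, hy⟩ := T.mem_graph_iff.1 (hT₁.mem_graph_iff.1 hxy)
        exact T.mem_graph_iff.2 ⟨⟨T x', hTr x'⟩, hy, hT2 x'⟩)
      (fun z p q b c hzp hpq hzb hbc =>
        Submodule.inner_left_of_mem_orthogonal
          (hrange (z := z) (hPgraph (hS₂.mem_graph_iff.1 hzp) (hT₁.mem_graph_iff.1 hpq)
            (hT₂.mem_graph_iff.1 hzb) (hS₃.mem_graph_iff.1 hbc))) hw)
    have hP := hPgraph (hS₂.mem_graph_iff.1 h1) T.graph.zero_mem (hT₂.mem_graph_iff.1 h2)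
      T†.graph.zero_mem
    rw [add_zero] at hP
    obtain ⟨x, hxw, hx⟩ := Q.mem_graph_iff.1 (hQ.mem_graph_iff (y := 0).2 hP)
    exact hN0 w ⟨x, hx, hxw⟩
  intro u
  obtain ⟨r, hr, w, hw, rfl⟩ := (LinearMap.range Q.toFun).exists_add_mem_mem_orthogonal u
  have hNu : N (r + w) = N r := by rw [map_add, hNorth w hw, add_zero]
  rw [hNu]
  obtain ⟨⟨n, hn⟩, hnN, hPn⟩ := P.mem_graph_iff.1 (hNgraph hr)
  dsimp only at hnN hPn
  subst hnN
  obtain ⟨h1, h2, h3, h4⟩ := (hPdom _).1 hn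
  refine ⟨h1, h2, (hNR r hr).2.1, fun v hv1 hv2 hv => ?_⟩
  have e1 := LinearPMap.adjoint_isFormalAdjoint hTd ⟨_, h3⟩ ⟨(v : H), hv1⟩
  have e2 := (LinearPMap.adjoint_isFormalAdjoint hTd).symm ⟨_, h4⟩ ⟨(v : H), hv2⟩
  have e3 : inner ℂ (w : H) (v : H) = 0 :=
    Submodule.inner_left_of_mem_orthogonal (u := v) (v := w) hv hw
  rw [Submodule.coe_add, inner_add_left, e3, add_zero, ← hPn, hPval _ hn h1 h2 h3 h4,
    inner_add_left, e1, e2]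
end
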